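/- Let 2<p<∞ and let (ζₙ) be a sequence of nonnegative functions on Π, each Steiner symmetric about the x₂-axis, such that the sequences (‖ζₙ‖₁) and (I(ζₙ)) are bounded and ζₙ → ζ weakly in L^p(Π). Then E(ζₙ) → E(ζ) as n → ∞. -/

import Mathlib

open MeasureTheory Real Filter Topology

noncomputable section

/-- The open upper half-plane Π. -/
def UHP : Set (ℝ × ℝ) := {x | 0 < x.2}

/-- Planar Lebesgue measure restricted to the upper half-plane. -/
def μUH : Measure (ℝ × ℝ) := MeasureTheory.volume.restrict UHP

/-- Squared Euclidean distance in the plane. -/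
def sqdist (x y : ℝ × ℝ) : ℝ := (x.1 - y.1) ^ 2 + (x.2 - y.2) ^ 2

/-- Euclidean distance in the plane. -/
def euclDist (x y : ℝ × ℝ) : ℝ := Real.sqrt (sqdist x y)

/-- The Green's function of −Δ in the upper half-plane:
`G(x,y) = (1/(4π)) log(1 + 4 x₂ y₂ / |x−y|²)`. -/
def greenG (x y : ℝ × ℝ) : ℝ :=
  (4 * π)⁻¹ * Real.log (1 + 4 * x.2 * y.2 / sqdist x y)

/-- The stream-function operator `𝒢ζ(x) = ∫_Π G(x,y) ζ(y) dy`. -/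
def Gop (ζ : ℝ × ℝ → ℝ) (x : ℝ × ℝ) : ℝ := ∫ y, greenG x y * ζ y ∂μUH

/-- Kinetic energy `E(ζ) = (1/2) ∫_Π ζ 𝒢ζ`. -/
def energy (ζ : ℝ × ℝ → ℝ) : ℝ := (1 / 2) * ∫ x, ζ x * Gop ζ x ∂μUH

/-- Impulse `I(ζ) = ∫_Π ζ(y) y₂ dy`. -/
def impulse (ζ : ℝ × ℝ → ℝ) : ℝ := ∫ y, ζ y * y.2 ∂μUH

/-- The `L^p(Π)` norm, as a real number. -/
def lpN (p : ℝ) (ζ : ℝ × ℝ → ℝ) : ℝ := (eLpNorm ζ (ENNReal.ofReal p) μUH).toReal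

/-- `f ⪯ g` : `∫ (f−a)₊ ≤ ∫ (g−a)₊` for every `a > 0`. -/
def prec (f g : ℝ × ℝ → ℝ) : Prop :=
  ∀ a : ℝ, 0 < a → ∫ x, max (f x - a) 0 ∂μUH ≤ ∫ x, max (g x - a) 0 ∂μUH

/-- `f` is a rearrangement of `g` on Π. -/
def IsRearr (f g : ℝ × ℝ → ℝ) : Prop :=
  ∀ a : ℝ, 0 < a → μUH {x | a < f x} = μUH {x | a < g x}

/-- Membership of the relaxed constraint class `𝒲(ζ₀)`. -/
def memW (ζ₀ ζ : ℝ × ℝ → ℝ) : Prop :=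
  (∀ x, 0 ≤ ζ x) ∧ Integrable ζ μUH ∧ prec ζ ζ₀

/-- `𝒲(ζ₀, ≤ i₀)`. -/
def Wle (ζ₀ : ℝ × ℝ → ℝ) (i₀ : ℝ) : Set (ℝ × ℝ → ℝ) :=
  {ζ | memW ζ₀ ζ ∧ impulse ζ ≤ i₀}

/-- `𝒲(ζ₀, i₀)`. -/
def Weq (ζ₀ : ℝ × ℝ → ℝ) (i₀ : ℝ) : Set (ℝ × ℝ → ℝ) :=
  {ζ | memW ζ₀ ζ ∧ impulse ζ = i₀}

/-- Membership of `ℛ⁺(ζ₀)`: restrictions of rearrangements of `ζ₀`. -/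
def memRplus (ζ₀ ζ : ℝ × ℝ → ℝ) : Prop :=
  ∃ ξ : ℝ × ℝ → ℝ, ∃ A : Set (ℝ × ℝ), IsRearr ξ ζ₀ ∧ MeasurableSet A ∧
    ζ = A.indicator ξ

/-- Steiner symmetry about the `x₂`-axis. -/
def SteinerSym (ζ : ℝ × ℝ → ℝ) : Prop :=
  ∀ᵐ t ∂(MeasureTheory.volume.restrict (Set.Ioi (0 : ℝ))),
    (∀ s : ℝ, ζ (-s, t) = ζ (s, t)) ∧
    (∀ s₁ s₂ : ℝ, 0 ≤ s₁ → s₁ ≤ s₂ → ζ (s₂, t) ≤ ζ (s₁, t))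

/-- The decreasing rearrangement `ζ^Δ(s) = inf {a > 0 : |{ζ > a}| ≤ s}`. -/
def decRearr (ζ : ℝ × ℝ → ℝ) (s : ℝ) : ℝ :=
  sInf {a : ℝ | 0 < a ∧ μUH {x | a < ζ x} ≤ ENNReal.ofReal s}

/-- The norm `‖ζ‖_{𝔛^p} = |I(ζ)| + ‖ζ‖₁ + ‖ζ‖_p`. -/
def XpNorm (p : ℝ) (ζ : ℝ × ℝ → ℝ) : ℝ := |impulse ζ| + lpN 1 ζ + lpN p ζ

/-- Distance to a set of functions in the `𝔛^p` norm. -/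
def XpDist (p : ℝ) (ζ : ℝ × ℝ → ℝ) (S : Set (ℝ × ℝ → ℝ)) : ℝ :=
  sInf ((fun σ => XpNorm p fun x => ζ x - σ x) '' S)


/-! ### Kernel bounds -/

lemma uhp_meas : MeasurableSet UHP := measurableSet_lt measurable_const measurable_snd

lemma ae_uhp : ∀ᵐ x ∂μUH, 0 < x.2 := ae_restrict_mem uhp_meas

lemma greenG_meas : Measurable (fun z : (ℝ × ℝ) × (ℝ × ℝ) => greenG z.1 z.2) := by
  unfold greenG sqdist
  fun_prop

lemma greenG_nonneg {x y : ℝ × ℝ} (hx : 0 < x.2) (hy : 0 < y.2) : 0 ≤ greenG x y := by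
  unfold greenG
  have h1 : 0 ≤ 4 * x.2 * y.2 / sqdist x y := by unfold sqdist; positivity
  have := Real.log_nonneg (by linarith : 1 ≤ 1 + 4 * x.2 * y.2 / sqdist x y)
  positivity

lemma greenG_le_log {x y : ℝ × ℝ} (hx : 0 < x.2) (hy : 0 < y.2) (hxy : x ≠ y) :
    greenG x y ≤ 2⁻¹ * Real.log (1 + 2 * y.2 / ‖x - y‖) := by
  have hd : 0 < ‖x - y‖ := norm_pos_iff.2 (sub_ne_zero.2 hxy)
  set d := ‖x - y‖ with hdd
  have h1 : |x.1 - y.1| ≤ d := norm_fst_le (x - y)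
  have h2 : |x.2 - y.2| ≤ d := norm_snd_le (x - y)
  have hs : d ^ 2 ≤ sqdist x y := by
    unfold sqdist
    have : d = max |x.1 - y.1| |x.2 - y.2| := rfl
    rcases max_choice |x.1 - y.1| |x.2 - y.2| with h | h
    · rw [this, h, sq_abs]; nlinarith [sq_nonneg (x.2 - y.2)]
    · rw [this, h, sq_abs]; nlinarith [sq_nonneg (x.1 - y.1)]
  have hx2 : x.2 ≤ y.2 + d := by linarith [le_abs_self (x.2 - y.2)]
  have h3 : 1 + 4 * x.2 * y.2 / sqdist x y ≤ (1 + 2 * y.2 / d) ^ 2 := by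
    have e1 : 4 * x.2 * y.2 / sqdist x y ≤ 4 * x.2 * y.2 / d ^ 2 := by gcongr
    have e2 : 4 * x.2 * y.2 / d ^ 2 ≤ 4 * (y.2 + d) * y.2 / d ^ 2 := by gcongr
    have e3 : 1 + 4 * (y.2 + d) * y.2 / d ^ 2 = (1 + 2 * y.2 / d) ^ 2 := by field_simp; ring
    linarith
  have h0 : 0 ≤ 4 * x.2 * y.2 / sqdist x y := by unfold sqdist; positivity
  have h4 : Real.log (1 + 4 * x.2 * y.2 / sqdist x y) ≤ 2 * Real.log (1 + 2 * y.2 / d) := by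
    have := Real.log_le_log (by linarith) h3
    rwa [Real.log_pow] at this
  have h5 : 0 ≤ Real.log (1 + 2 * y.2 / d) := Real.log_nonneg (by
    have : 0 ≤ 2 * y.2 / d := by positivity
    linarith)
  unfold greenG
  have h6 : (4 * π)⁻¹ ≤ 4⁻¹ := by
    apply inv_anti₀ (by norm_num); linarith [Real.two_le_pi]
  calc _ ≤ (4 * π)⁻¹ * (2 * Real.log (1 + 2 * y.2 / d)) := by gcongr
    _ ≤ 4⁻¹ * (2 * Real.log (1 + 2 * y.2 / d)) := by gcongr
    _ = _ := by ring

lemma greenG_self (x : ℝ × ℝ) : greenG x x = 0 := by simp [greenG, sqdist]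

lemma greenG_le_far {x y : ℝ × ℝ} (hx : 0 < x.2) (hy : 0 < y.2) :
    greenG x y ≤ y.2 / ‖x - y‖ := by
  by_cases hxy : x = y
  · subst hxy; simp [greenG_self]
  have hd : 0 < ‖x - y‖ := norm_pos_iff.2 (sub_ne_zero.2 hxy)
  have h := greenG_le_log hx hy hxy
  have h1 := Real.log_le_sub_one_of_pos (x := 1 + 2 * y.2 / ‖x - y‖) (by positivity)
  have : 2 * y.2 / ‖x - y‖ = 2 * (y.2 / ‖x - y‖) := by ring
  linarith

lemma greenG_le_near {x y : ℝ × ℝ} (hx : 0 < x.2) (hy : 0 < y.2) :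
    greenG x y ≤ y.2 + ‖x - y‖⁻¹ := by
  by_cases hxy : x = y
  · subst hxy; simp [greenG_self, hy.le]
  have hd : 0 < ‖x - y‖ := norm_pos_iff.2 (sub_ne_zero.2 hxy)
  have h := greenG_le_log hx hy hxy
  have h1 := Real.log_le_sub_one_of_pos (x := 1 + 2 * y.2) (by positivity)
  have h2 := Real.log_le_sub_one_of_pos (x := 1 + ‖x - y‖⁻¹) (by positivity)
  have h3 : Real.log (1 + 2 * y.2 / ‖x - y‖) ≤ Real.log ((1 + 2 * y.2) * (1 + ‖x - y‖⁻¹)) := by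
    apply Real.log_le_log (by positivity)
    have : (1 + 2 * y.2) * (1 + ‖x - y‖⁻¹) = 1 + 2 * y.2 / ‖x - y‖ + (2 * y.2 + ‖x - y‖⁻¹) := by
      ring
    rw [this]
    have : 0 ≤ 2 * y.2 + ‖x - y‖⁻¹ := by positivity
    linarith
  rw [Real.log_mul (by positivity) (by positivity)] at h3
  have : 0 < ‖x - y‖⁻¹ := by positivity
  linarith

/-- Combined bound. -/
lemma greenG_le {x y : ℝ × ℝ} (hx : 0 < x.2) (hy : 0 < y.2) :
    greenG x y ≤ y.2 + (Metric.ball x 1).indicator (fun y => ‖x - y‖⁻¹) y := by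
  by_cases h : y ∈ Metric.ball x 1
  · rw [Set.indicator_of_mem h]; exact greenG_le_near hx hy
  · rw [Set.indicator_of_notMem h, add_zero]
    refine (greenG_le_far hx hy).trans ?_
    rw [Metric.mem_ball, dist_comm, dist_eq_norm, not_lt] at h
    exact div_le_self hy.le h

/-- The `L^q` norm of the local singularity. -/
def kap (q : ℝ) : ENNReal :=
  (∫⁻ z in Metric.ball (0 : ℝ × ℝ) 1, (ENNReal.ofReal ‖z‖⁻¹) ^ q) ^ (1 / q)

lemma kap_int {q : ℝ} (hq : 0 < q) (hq2 : q < 2) :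
    ∫⁻ z in Metric.ball (0 : ℝ × ℝ) 1, (ENNReal.ofReal ‖z‖⁻¹) ^ q < ⊤ := by
  have h : IntegrableOn (fun z : ℝ × ℝ => (‖z‖⁻¹) ^ q) (Metric.ball 0 1) volume := by
    rw [integrableOn_fun_norm_addHaar volume (f := fun r => r⁻¹ ^ q)]
    have : IntegrableOn (fun y : ℝ => y ^ (1 - q)) (Set.Ioo 0 1) :=
      (intervalIntegral.integrableOn_Ioo_rpow_iff one_pos).2 (by linarith)
    refine this.congr_fun (fun y hy => ?_) measurableSet_Ioo
    have hy0 : 0 < y := hy.1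
    simp [Real.inv_rpow hy0.le, Real.rpow_sub hy0, div_eq_mul_inv]
  have h2 := h.lintegral_lt_top
  refine lt_of_eq_of_lt (lintegral_congr fun z => ?_) h2
  exact ENNReal.ofReal_rpow_of_nonneg (by positivity) hq.le

lemma kap_lt_top {q : ℝ} (hq : 0 < q) (hq2 : q < 2) : kap q < ⊤ :=
  ENNReal.rpow_lt_top_of_nonneg (by positivity) (kap_int hq hq2).ne

lemma sing_le {q : ℝ} (hq : 0 < q) (x : ℝ × ℝ) :
    (∫⁻ y, (ENNReal.ofReal ((Metric.ball x 1).indicator (fun y => ‖x - y‖⁻¹) y)) ^ q ∂μUH) ^ (1 / q)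
      ≤ kap q := by
  unfold kap
  refine ENNReal.rpow_le_rpow ?_ (by positivity)
  refine (lintegral_mono' (Measure.restrict_le_self) le_rfl).trans ?_
  rw [← lintegral_indicator Metric.isOpen_ball.measurableSet]
  rw [← lintegral_sub_left_eq_self ((Metric.ball (0 : ℝ × ℝ) 1).indicator _) x]
  refine lintegral_mono fun y => ?_
  by_cases h : y ∈ Metric.ball x 1
  · have : x - y ∈ Metric.ball (0 : ℝ × ℝ) 1 := by
      simpa [dist_eq_norm, norm_sub_rev] using h
    simp only [Set.indicator_of_mem h, Set.indicator_of_mem this, le_refl]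
  · simp [Set.indicator_of_notMem h, hq]

/-! ### Potential bounds -/

lemma green_set_bound {p q : ℝ} (hpq : p.HolderConjugate q) {f : ℝ × ℝ → ℝ}
    (hf0 : ∀ x, 0 ≤ f x) (hfm : AEMeasurable f μUH) {x : ℝ × ℝ} (hx : 0 < x.2)
    (S : Set (ℝ × ℝ)) :
    ∫⁻ y in S, ENNReal.ofReal (greenG x y * f y) ∂μUH ≤
      ∫⁻ y in S, ENNReal.ofReal (f y * y.2) ∂μUH +
        (∫⁻ y in S, ENNReal.ofReal (f y) ^ p ∂μUH) ^ (1 / p) * kap q := by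
  set h : ℝ × ℝ → ℝ := (Metric.ball x 1).indicator (fun y => ‖x - y‖⁻¹) with hh
  have hm : Measurable h := by
    apply Measurable.indicator _ Metric.isOpen_ball.measurableSet
    fun_prop
  have hh0 : ∀ y, 0 ≤ h y := fun y => Set.indicator_nonneg (fun _ _ => by positivity) y
  have hfm' : AEMeasurable f (μUH.restrict S) := hfm.mono_measure Measure.restrict_le_self
  have key : ∀ᵐ y ∂(μUH.restrict S), ENNReal.ofReal (greenG x y * f y) ≤
      ENNReal.ofReal (f y * y.2) +
        ((fun y => ENNReal.ofReal (f y)) * fun y => ENNReal.ofReal (h y)) y := by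
    filter_upwards [ae_restrict_of_ae ae_uhp] with y hy
    simp only [Pi.mul_apply]
    rw [← ENNReal.ofReal_mul (hf0 y), ← ENNReal.ofReal_add (mul_nonneg (hf0 y) hy.le)
      (mul_nonneg (hf0 y) (hh0 y))]
    apply ENNReal.ofReal_le_ofReal
    have := mul_le_mul_of_nonneg_left (greenG_le hx hy) (hf0 y)
    linarith
  refine (lintegral_mono_ae key).trans ?_
  rw [lintegral_add_left' (by fun_prop)]
  gcongr
  refine (ENNReal.lintegral_mul_le_Lp_mul_Lq _ hpq (by fun_prop) (by fun_prop)).trans ?_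
  gcongr
  refine le_trans ?_ (sing_le hpq.symm.pos x)
  refine ENNReal.rpow_le_rpow ?_ (by have := hpq.symm.pos; positivity)
  exact lintegral_mono' Measure.restrict_le_self le_rfl

lemma green_far_bound {f : ℝ × ℝ → ℝ}
    (hf0 : ∀ x, 0 ≤ f x) {x : ℝ × ℝ} (hx : 0 < x.2) {ρ : ℝ} (hρ : 0 < ρ) :
    ∫⁻ y in {y | ρ ≤ ‖x - y‖}, ENNReal.ofReal (greenG x y * f y) ∂μUH ≤
      ENNReal.ofReal ρ⁻¹ * ∫⁻ y, ENNReal.ofReal (f y * y.2) ∂μUH := by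
  rw [← lintegral_const_mul' _ _ ENNReal.ofReal_ne_top]
  have hS : MeasurableSet {y : ℝ × ℝ | ρ ≤ ‖x - y‖} :=
    measurableSet_le measurable_const (by fun_prop)
  refine le_trans ?_ (lintegral_mono' (Measure.restrict_le_self
    (s := {y : ℝ × ℝ | ρ ≤ ‖x - y‖})) le_rfl)
  apply lintegral_mono_ae
  filter_upwards [ae_restrict_of_ae ae_uhp, ae_restrict_mem hS] with y hy hyS
  rw [← ENNReal.ofReal_mul (by positivity)]
  apply ENNReal.ofReal_le_ofReal
  have h1 : greenG x y ≤ ρ⁻¹ * y.2 := by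
    refine (greenG_le_far hx hy).trans ?_
    rw [div_eq_inv_mul]
    have : ‖x - y‖⁻¹ ≤ ρ⁻¹ := inv_anti₀ hρ hyS
    gcongr
  have := mul_le_mul_of_nonneg_right h1 (hf0 y)
  linarith

/-! ### Steiner symmetry -/

lemma muUH_prod : μUH = (volume : Measure ℝ).prod (volume.restrict (Set.Ioi (0 : ℝ))) := by
  have h : UHP = Set.univ ×ˢ Set.Ioi (0 : ℝ) := by ext x; simp [UHP]
  have := Measure.prod_restrict (μ := (volume : Measure ℝ)) (ν := (volume : Measure ℝ))
    Set.univ (Set.Ioi (0 : ℝ))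
  rw [Measure.restrict_univ] at this
  rw [this, μUH, h]; rfl

lemma strip_one_dim {φ : ℝ → ENNReal} (he : ∀ s, φ (-s) = φ s)
    (ha : ∀ s₁ s₂ : ℝ, 0 ≤ s₁ → s₁ ≤ s₂ → φ s₂ ≤ φ s₁) {ρ a : ℝ} (hρ : 0 < ρ)
    (hR : ρ ^ 2 + ρ ≤ |a|) :
    ENNReal.ofReal ρ * ∫⁻ s in Metric.ball a ρ, φ s ≤ ∫⁻ s, φ s := by
  have habs : ∀ s, φ |s| = φ s := fun s => by
    rcases abs_choice s with h | h <;> rw [h]; exact he s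
  have h1 : ∫⁻ s in Metric.ball a ρ, φ s ≤ ENNReal.ofReal (2 * ρ) * φ (ρ ^ 2) := by
    rw [← Real.volume_ball a ρ, mul_comm, ← setLIntegral_const]
    apply setLIntegral_mono measurable_const
    intro s hs
    rw [← habs]
    apply ha _ _ (by positivity)
    rw [Metric.mem_ball, Real.dist_eq] at hs
    have := abs_sub_abs_le_abs_sub a s
    rw [abs_sub_comm] at this
    linarith
  have h2 : ENNReal.ofReal (2 * ρ ^ 2) * φ (ρ ^ 2) ≤ ∫⁻ s, φ s := by
    rw [← Real.volume_ball 0 (ρ ^ 2), mul_comm, ← setLIntegral_const]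
    refine le_trans ?_ (setLIntegral_le_lintegral (Metric.ball 0 (ρ ^ 2)) _)
    apply lintegral_mono_ae
    filter_upwards [ae_restrict_mem Metric.isOpen_ball.measurableSet] with s hs
    rw [← habs s]
    apply ha _ _ (by positivity)
    rw [Metric.mem_ball, Real.dist_eq, sub_zero] at hs
    exact hs.le
  refine le_trans ?_ h2
  calc _ ≤ ENNReal.ofReal ρ * (ENNReal.ofReal (2 * ρ) * φ (ρ ^ 2)) := by gcongr
    _ = _ := by
      rw [← mul_assoc, ← ENNReal.ofReal_mul hρ.le]; congr 2; ring

lemma strip_bound {f : ℝ × ℝ → ENNReal} (hf : AEMeasurable f μUH)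
    (hs : ∀ᵐ t ∂(volume.restrict (Set.Ioi (0 : ℝ))), (∀ s : ℝ, f (-s, t) = f (s, t)) ∧
      (∀ s₁ s₂ : ℝ, 0 ≤ s₁ → s₁ ≤ s₂ → f (s₂, t) ≤ f (s₁, t))) {ρ a : ℝ} (hρ : 0 < ρ)
    (hR : ρ ^ 2 + ρ ≤ |a|) :
    ENNReal.ofReal ρ * ∫⁻ y in (Metric.ball a ρ) ×ˢ Set.univ, f y ∂μUH ≤ ∫⁻ y, f y ∂μUH := by
  have hf' := hf
  rw [muUH_prod] at hf'
  have e : μUH.restrict ((Metric.ball a ρ) ×ˢ Set.univ) =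
      (volume.restrict (Metric.ball a ρ)).prod (volume.restrict (Set.Ioi (0 : ℝ))) := by
    rw [muUH_prod, ← Measure.prod_restrict, Measure.restrict_univ]
  have hf2 := hf.mono_measure (Measure.restrict_le_self (s := (Metric.ball a ρ) ×ˢ Set.univ))
  rw [e] at hf2
  rw [e, lintegral_prod_symm _ hf2, muUH_prod, lintegral_prod_symm _ hf',
    ← lintegral_const_mul' _ _ ENNReal.ofReal_ne_top]
  apply lintegral_mono_ae
  filter_upwards [hs] with t ht
  exact strip_one_dim (φ := fun s => f (s, t)) ht.1 ht.2 hρ hR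

/-! ### Good functions -/

/-- Nonnegative functions with uniformly bounded mass, impulse and `L^p` norm. -/
structure Good (p : ℝ) (A : ℝ) (f : ℝ × ℝ → ℝ) : Prop where
  nonneg : ∀ x, 0 ≤ f x
  meas : AEMeasurable f μUH
  mass : ∫⁻ y, ENNReal.ofReal (f y) ∂μUH ≤ ENNReal.ofReal A
  imp : ∫⁻ y, ENNReal.ofReal (f y * y.2) ∂μUH ≤ ENNReal.ofReal A
  lp : (∫⁻ y, ENNReal.ofReal (f y) ^ p ∂μUH) ^ (1 / p) ≤ ENNReal.ofReal A

/-- Potential as a lower integral. -/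
def Lop (f : ℝ × ℝ → ℝ) (x : ℝ × ℝ) : ENNReal := ∫⁻ y, ENNReal.ofReal (greenG x y * f y) ∂μUH

/-- Uniform bound for the potential. -/
def Cb (q A : ℝ) : ℝ := A + A * (kap q).toReal

lemma greenG_mul_nonneg {f : ℝ × ℝ → ℝ} (hf0 : ∀ x, 0 ≤ f x) {x : ℝ × ℝ} (hx : 0 < x.2) :
    0 ≤ᵐ[μUH] fun y => greenG x y * f y := by
  filter_upwards [ae_uhp] with y hy
  exact mul_nonneg (greenG_nonneg hx hy) (hf0 y)

lemma greenG_meas_right (x : ℝ × ℝ) : Measurable (fun y => greenG x y) :=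
  greenG_meas.comp (measurable_const.prodMk measurable_id)

section
variable {p q A : ℝ} {f : ℝ × ℝ → ℝ}

lemma Lop_le (hpq : p.HolderConjugate q) (hq2 : q < 2) (hA : 0 ≤ A) (hf : Good p A f)
    {x : ℝ × ℝ} (hx : 0 < x.2) : Lop f x ≤ ENNReal.ofReal (Cb q A) := by
  have h := green_set_bound hpq hf.nonneg hf.meas hx Set.univ
  simp only [Measure.restrict_univ] at h
  have hk := kap_lt_top hpq.symm.pos hq2
  unfold Lop Cb
  refine h.trans ?_
  rw [ENNReal.ofReal_add hA (by positivity), ENNReal.ofReal_mul hA, ENNReal.ofReal_toReal hk.ne]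
  gcongr
  · exact hf.imp
  · exact hf.lp

lemma Gop_eq (hf : Good p A f) {x : ℝ × ℝ} (hx : 0 < x.2) : Gop f x = (Lop f x).toReal := by
  unfold Gop Lop
  rw [integral_eq_lintegral_of_nonneg_ae (greenG_mul_nonneg hf.nonneg hx)]
  exact ((greenG_meas_right x).aemeasurable.mul hf.meas).aestronglyMeasurable

lemma Gop_nonneg (hf : Good p A f) {x : ℝ × ℝ} (hx : 0 < x.2) : 0 ≤ Gop f x := by
  rw [Gop_eq hf hx]; exact ENNReal.toReal_nonneg

lemma Cb_nonneg (hA : 0 ≤ A) : 0 ≤ Cb q A := by unfold Cb; positivity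

lemma Gop_le (hpq : p.HolderConjugate q) (hq2 : q < 2) (hA : 0 ≤ A) (hf : Good p A f)
    {x : ℝ × ℝ} (hx : 0 < x.2) : Gop f x ≤ Cb q A := by
  rw [Gop_eq hf hx]
  exact ENNReal.toReal_le_of_le_ofReal (Cb_nonneg hA) (Lop_le hpq hq2 hA hf hx)

lemma ofReal_Gop (hpq : p.HolderConjugate q) (hq2 : q < 2) (hA : 0 ≤ A) (hf : Good p A f)
    {x : ℝ × ℝ} (hx : 0 < x.2) : ENNReal.ofReal (Gop f x) = Lop f x := by
  rw [Gop_eq hf hx, ENNReal.ofReal_toReal]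
  exact (lt_of_le_of_lt (Lop_le hpq hq2 hA hf hx) ENNReal.ofReal_lt_top).ne

/-- Smallness of the potential far out in the horizontal direction. -/
def eb (p q A ρ : ℝ) : ℝ := 2 * A * ρ⁻¹ + ρ⁻¹ ^ (1 / p) * A * (kap q).toReal

lemma eb_nonneg (hA : 0 ≤ A) {ρ : ℝ} (hρ : 0 < ρ) : 0 ≤ eb p q A ρ := by unfold eb; positivity

lemma le_inv_mul_of {a b : ENNReal} {ρ : ℝ} (hρ : 0 < ρ) (h : ENNReal.ofReal ρ * a ≤ b) :
    a ≤ ENNReal.ofReal ρ⁻¹ * b := by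
  calc a = ENNReal.ofReal ρ⁻¹ * (ENNReal.ofReal ρ * a) := by
        rw [← mul_assoc, ← ENNReal.ofReal_mul (by positivity), inv_mul_cancel₀ hρ.ne']; simp
    _ ≤ _ := by gcongr

lemma Lop_far (hpq : p.HolderConjugate q) (hq2 : q < 2) (hA : 0 ≤ A) (hf : Good p A f)
    (hsym : SteinerSym f) {x : ℝ × ℝ} (hx : 0 < x.2) {ρ : ℝ} (hρ : 0 < ρ)
    (hR : ρ ^ 2 + ρ ≤ |x.1|) : Lop f x ≤ ENNReal.ofReal (eb p q A ρ) := by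
  have hk := kap_lt_top hpq.symm.pos hq2
  set S : Set (ℝ × ℝ) := (Metric.ball x.1 ρ) ×ˢ Set.univ with hS
  set T : Set (ℝ × ℝ) := {y | ρ ≤ ‖x - y‖} with hT
  have hcov : S ∪ T = Set.univ := by
    ext y
    simp only [hS, hT, Set.mem_union, Set.mem_prod, Set.mem_univ, and_true, Set.mem_ofPred_eq,
      iff_true, Metric.mem_ball, Real.dist_eq]
    by_contra! h
    have : |x.1 - y.1| ≤ ‖x - y‖ := norm_fst_le (x - y)
    rw [abs_sub_comm] at this
    linarith
  have h1 : Lop f x ≤ ∫⁻ y in S, ENNReal.ofReal (greenG x y * f y) ∂μUH +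
      ∫⁻ y in T, ENNReal.ofReal (greenG x y * f y) ∂μUH := by
    unfold Lop
    rw [← setLIntegral_univ, ← hcov]
    exact lintegral_union_le _ _ _
  have hm := hf.meas
  have s1 : ∫⁻ y in S, ENNReal.ofReal (f y * y.2) ∂μUH ≤ ENNReal.ofReal ρ⁻¹ * ENNReal.ofReal A := by
    refine (le_inv_mul_of hρ (strip_bound (by fun_prop) ?_ hρ hR)).trans (by gcongr; exact hf.imp)
    filter_upwards [hsym, ae_restrict_mem measurableSet_Ioi] with t ht ht0
    refine ⟨fun s => by simp only [ht.1], fun s₁ s₂ h1 h2 => ?_⟩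
    have : (0 : ℝ) < t := ht0
    have := ht.2 s₁ s₂ h1 h2
    gcongr
  have s2 : (∫⁻ y in S, ENNReal.ofReal (f y) ^ p ∂μUH) ^ (1 / p) ≤
      ENNReal.ofReal (ρ⁻¹ ^ (1 / p)) * ENNReal.ofReal A := by
    have hp := hpq.pos
    have := le_inv_mul_of hρ (strip_bound (f := fun y => ENNReal.ofReal (f y) ^ p)
      (a := x.1) (by fun_prop) ?_ hρ hR)
    · have := ENNReal.rpow_le_rpow this (by positivity : 0 ≤ 1 / p)
      refine this.trans ?_
      rw [ENNReal.mul_rpow_of_nonneg _ _ (by positivity),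
        ENNReal.ofReal_rpow_of_nonneg (by positivity) (by positivity)]
      gcongr
      exact hf.lp
    · filter_upwards [hsym] with t ht
      refine ⟨fun s => by simp only [ht.1], fun s₁ s₂ h1 h2 => ?_⟩
      have := ht.2 s₁ s₂ h1 h2
      gcongr
  have s3 := green_set_bound hpq hf.nonneg hf.meas hx S
  have s4 := green_far_bound hf.nonneg hx hρ
  refine h1.trans ((add_le_add s3 s4).trans ?_)
  have e : eb p q A ρ = (ρ⁻¹ * A + ρ⁻¹ ^ (1 / p) * A * (kap q).toReal) + ρ⁻¹ * A := by
    unfold eb; ring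
  rw [e, ENNReal.ofReal_add (by positivity) (by positivity),
    ENNReal.ofReal_add (by positivity) (by positivity),
    ENNReal.ofReal_mul (p := ρ⁻¹ ^ (1 / p) * A) (by positivity),
    ENNReal.ofReal_mul (p := ρ⁻¹ ^ (1 / p)) (by positivity),
    ENNReal.ofReal_mul (p := ρ⁻¹) (by positivity), ENNReal.ofReal_toReal hk.ne]
  gcongr
  exact hf.imp

end

/-! ### Limits -/

lemma interchange {a : ℕ → ℕ → ℝ} {b c e e' : ℕ → ℝ} {l : ℝ}
    (h : ∀ k, Tendsto (a k) atTop (𝓝 (b k))) (he : Tendsto e atTop (𝓝 0))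
    (he' : Tendsto e' atTop (𝓝 0)) (h1 : ∀ k n, |c n - a k n| ≤ e k)
    (h2 : ∀ k, |l - b k| ≤ e' k) : Tendsto c atTop (𝓝 l) := by
  rw [Metric.tendsto_atTop]
  intro ε hε
  obtain ⟨k, hk1, hk2⟩ := ((he.eventually_lt_const (by positivity : 0 < ε / 3)).and
    (he'.eventually_lt_const (by positivity : 0 < ε / 3))).exists
  obtain ⟨N, hN⟩ := Metric.tendsto_atTop.1 (h k) (ε / 3) (by positivity)
  refine ⟨N, fun n hn => ?_⟩
  have h3 := hN n hn
  rw [Real.dist_eq] at h3 ⊢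
  have h4 := h1 k n
  have h5 := h2 k
  have e1 : c n - l = (c n - a k n) + (a k n - b k) + -(l - b k) := by ring
  rw [e1]
  have := abs_add_le ((c n - a k n) + (a k n - b k)) (-(l - b k))
  have := abs_add_le (c n - a k n) (a k n - b k)
  rw [abs_neg] at *
  linarith

section
variable {p q A : ℝ} {f : ℝ × ℝ → ℝ}

lemma green_integrable (hpq : p.HolderConjugate q) (hq2 : q < 2) (hA : 0 ≤ A) (hf : Good p A f)
    {x : ℝ × ℝ} (hx : 0 < x.2) : Integrable (fun y => greenG x y * f y) μUH := by
  refine ⟨((greenG_meas_right x).aemeasurable.mul hf.meas).aestronglyMeasurable, ?_⟩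
  rw [hasFiniteIntegral_iff_ofReal (greenG_mul_nonneg hf.nonneg hx)]
  exact lt_of_le_of_lt (Lop_le hpq hq2 hA hf hx) ENNReal.ofReal_lt_top

/-- Truncated kernel. -/
def hker (x : ℝ × ℝ) (ρ : ℝ) : ℝ × ℝ → ℝ := (Metric.ball x ρ).indicator (greenG x)

lemma trunc_bound (hpq : p.HolderConjugate q) (hq2 : q < 2) (hA : 0 ≤ A) (hf : Good p A f)
    {x : ℝ × ℝ} (hx : 0 < x.2) {ρ : ℝ} (hρ : 0 < ρ) :
    |Gop f x - ∫ y, f y * hker x ρ y ∂μUH| ≤ ρ⁻¹ * A := by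
  have hi := green_integrable hpq hq2 hA hf hx
  have hB : MeasurableSet (Metric.ball x ρ) := Metric.isOpen_ball.measurableSet
  have e1 : ∫ y, f y * hker x ρ y ∂μUH = ∫ y in Metric.ball x ρ, greenG x y * f y ∂μUH := by
    rw [← integral_indicator hB]
    congr 1; ext y
    unfold hker
    by_cases hy : y ∈ Metric.ball x ρ
    · simp only [Set.indicator_of_mem hy]; ring
    · simp only [Set.indicator_of_notMem hy]; ring
  have e2 : (Metric.ball x ρ)ᶜ = {y | ρ ≤ ‖x - y‖} := by
    ext y; simp [dist_eq_norm, norm_sub_rev]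
  rw [e1]
  unfold Gop
  rw [← integral_add_compl hB hi, add_sub_cancel_left, e2]
  rw [integral_eq_lintegral_of_nonneg_ae (ae_restrict_of_ae (greenG_mul_nonneg hf.nonneg hx))
    hi.integrableOn.aestronglyMeasurable, abs_of_nonneg ENNReal.toReal_nonneg]
  apply ENNReal.toReal_le_of_le_ofReal (by positivity)
  refine (green_far_bound hf.nonneg hx hρ).trans ?_
  rw [ENNReal.ofReal_mul (by positivity)]
  gcongr
  exact hf.imp

lemma hker_memLp (hpq : p.HolderConjugate q) (hq2 : q < 2) {x : ℝ × ℝ} (hx : 0 < x.2) {ρ : ℝ}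
    (hρ : 0 < ρ) : MemLp (hker x ρ) (ENNReal.ofReal q) μUH := by
  have hq := hpq.symm.pos
  have hB : MeasurableSet (Metric.ball x ρ) := Metric.isOpen_ball.measurableSet
  have m1 : MemLp ((Metric.ball x ρ).indicator (fun _ => x.2 + ρ)) (ENNReal.ofReal q) μUH := by
    apply memLp_indicator_const _ hB
    right
    exact (lt_of_le_of_lt (Measure.restrict_apply_le _ _) Metric.isBounded_ball.measure_lt_top).ne
  have m2 : MemLp ((Metric.ball x 1).indicator (fun y => ‖x - y‖⁻¹)) (ENNReal.ofReal q) μUH := by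
    refine ⟨?_, ?_⟩
    · apply Measurable.aestronglyMeasurable
      apply Measurable.indicator _ Metric.isOpen_ball.measurableSet
      fun_prop
    · rw [eLpNorm_eq_lintegral_rpow_enorm_toReal (by simpa using hq) ENNReal.ofReal_ne_top,
        ENNReal.toReal_ofReal hq.le]
      refine lt_of_le_of_lt ?_ (kap_lt_top hq hq2)
      refine le_trans (le_of_eq ?_) (sing_le hq x)
      congr 1
      apply lintegral_congr
      intro y
      rw [Real.enorm_eq_ofReal]
      exact Set.indicator_nonneg (fun _ _ => by positivity) y
  refine (m1.add m2).of_le ?_ ?_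
  · exact ((greenG_meas_right x).indicator hB).aestronglyMeasurable
  · filter_upwards [ae_uhp] with y hy
    have n2 : 0 ≤ (Metric.ball x 1).indicator (fun y => ‖x - y‖⁻¹) y :=
      Set.indicator_nonneg (fun _ _ => by positivity) y
    unfold hker
    by_cases hyB : y ∈ Metric.ball x ρ
    · simp only [Pi.add_apply, Set.indicator_of_mem hyB]
      rw [Real.norm_of_nonneg (greenG_nonneg hx hy), Real.norm_of_nonneg (by positivity)]
      refine (greenG_le hx hy).trans ?_
      gcongr
      rw [Metric.mem_ball, dist_eq_norm] at hyB
      have : |y.2 - x.2| ≤ ‖y - x‖ := norm_snd_le (y - x)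
      linarith [le_abs_self (y.2 - x.2)]
    · simp [Set.indicator_of_notMem hyB]

lemma tendsto_inv_succ : Tendsto (fun k : ℕ => ((k : ℝ) + 1)⁻¹) atTop (𝓝 0) := by
  simpa [one_div] using tendsto_one_div_add_atTop_nhds_zero_nat (𝕜 := ℝ)

lemma Gop_tendsto (hpq : p.HolderConjugate q) (hq2 : q < 2) (hA : 0 ≤ A)
    {ζn : ℕ → ℝ × ℝ → ℝ} {ζ : ℝ × ℝ → ℝ} (hn : ∀ n, Good p A (ζn n)) (hζ : Good p A ζ)
    (hweak : ∀ g : ℝ × ℝ → ℝ, MemLp g (ENNReal.ofReal q) μUH →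
      Tendsto (fun n => ∫ x, ζn n x * g x ∂μUH) atTop (nhds (∫ x, ζ x * g x ∂μUH)))
    {x : ℝ × ℝ} (hx : 0 < x.2) : Tendsto (fun n => Gop (ζn n) x) atTop (𝓝 (Gop ζ x)) := by
  have he : Tendsto (fun k : ℕ => ((k : ℝ) + 1)⁻¹ * A) atTop (𝓝 0) := by
    simpa using tendsto_inv_succ.mul_const A
  exact interchange (fun k => hweak _ (hker_memLp hpq hq2 hx (by positivity : (0:ℝ) < k + 1)))
    he he (fun k n => trunc_bound hpq hq2 hA (hn n) hx (by positivity))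
    (fun k => trunc_bound hpq hq2 hA hζ hx (by positivity))

lemma Gop_meas (hf : Good p A f) : AEStronglyMeasurable (Gop f) μUH := by
  have : SFinite μUH := by unfold μUH; infer_instance
  have h : AEStronglyMeasurable (fun z : (ℝ × ℝ) × (ℝ × ℝ) => greenG z.1 z.2 * f z.2)
      (μUH.prod μUH) :=
    greenG_meas.aestronglyMeasurable.mul hf.meas.aestronglyMeasurable.comp_snd
  exact h.integral_prod_right'

lemma Good.integrable (hf : Good p A f) : Integrable f μUH := by
  refine ⟨hf.meas.aestronglyMeasurable, ?_⟩
  rw [hasFiniteIntegral_iff_ofReal (ae_of_all _ hf.nonneg)]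
  exact lt_of_le_of_lt hf.mass ENNReal.ofReal_lt_top

lemma energy_integrable (hpq : p.HolderConjugate q) (hq2 : q < 2) (hA : 0 ≤ A)
    (hf : Good p A f) : Integrable (fun x => f x * Gop f x) μUH := by
  refine hf.integrable.mul_bdd (c := Cb q A) (Gop_meas hf) ?_
  filter_upwards [ae_uhp] with x hx
  rw [Real.norm_of_nonneg (Gop_nonneg hf hx)]
  exact Gop_le hpq hq2 hA hf hx

/-- Boxes. -/
def bx (R : ℝ) : Set (ℝ × ℝ) := {x | |x.1| ≤ R ∧ x.2 ≤ R}

lemma bx_meas (R : ℝ) : MeasurableSet (bx R) :=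
  (measurableSet_le (f := fun x : ℝ × ℝ => |x.1|) (by fun_prop) measurable_const).inter
    (measurableSet_le measurable_snd measurable_const)

lemma bx_finite (R : ℝ) : μUH (bx R) < ⊤ := by
  unfold μUH
  rw [Measure.restrict_apply (bx_meas R)]
  refine lt_of_le_of_lt (measure_mono ?_) (isCompact_Icc (a := ((-R, 0) : ℝ × ℝ))
    (b := (R, R))).measure_lt_top
  rintro x ⟨⟨h1, h2⟩, h3⟩
  have := abs_le.1 h1
  exact ⟨⟨this.1, le_of_lt h3⟩, ⟨this.2, h2⟩⟩

lemma tail_bound (hpq : p.HolderConjugate q) (hq2 : q < 2) (hA : 0 ≤ A) (hf : Good p A f)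
    (hsym : SteinerSym f) {ρ : ℝ} (hρ : 0 < ρ) :
    |∫ x, f x * Gop f x ∂μUH - ∫ x in bx (ρ ^ 2 + ρ), f x * Gop f x ∂μUH| ≤
      Cb q A * (ρ ^ 2 + ρ)⁻¹ * A + eb p q A ρ * A := by
  set R := ρ ^ 2 + ρ with hRdef
  have hR : 0 < R := by positivity
  have hC := Cb_nonneg (q := q) hA
  have hE := eb_nonneg (p := p) (q := q) hA hρ
  have hi := energy_integrable hpq hq2 hA hf
  have hnn : 0 ≤ᵐ[μUH] fun x => f x * Gop f x := by
    filter_upwards [ae_uhp] with x hx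
    exact mul_nonneg (hf.nonneg x) (Gop_nonneg hf hx)
  rw [← integral_add_compl (bx_meas R) hi, add_sub_cancel_left,
    integral_eq_lintegral_of_nonneg_ae (ae_restrict_of_ae hnn)
    hi.integrableOn.aestronglyMeasurable, abs_of_nonneg ENNReal.toReal_nonneg]
  apply ENNReal.toReal_le_of_le_ofReal (by positivity)
  have key : ∀ᵐ x ∂(μUH.restrict (bx R)ᶜ), ENNReal.ofReal (f x * Gop f x) ≤
      ENNReal.ofReal (Cb q A * R⁻¹) * ENNReal.ofReal (f x * x.2) +
        ENNReal.ofReal (eb p q A ρ) * ENNReal.ofReal (f x) := by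
    filter_upwards [ae_restrict_of_ae ae_uhp, ae_restrict_mem (bx_meas R).compl] with x hx hxB
    have hfx := hf.nonneg x
    rw [← ENNReal.ofReal_mul (by positivity), ← ENNReal.ofReal_mul (by positivity),
      ← ENNReal.ofReal_add (by positivity) (by positivity)]
    apply ENNReal.ofReal_le_ofReal
    by_cases h2 : x.2 ≤ R
    · have h1 : R ≤ |x.1| := by
        by_contra! h
        exact hxB ⟨h.le, h2⟩
      have hG : Gop f x ≤ eb p q A ρ := by
        rw [Gop_eq hf hx]
        exact ENNReal.toReal_le_of_le_ofReal hE (Lop_far hpq hq2 hA hf hsym hx hρ h1)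
      have := mul_le_mul_of_nonneg_left hG hfx
      have : 0 ≤ Cb q A * R⁻¹ * (f x * x.2) := by positivity
      linarith
    · have hG := Gop_le hpq hq2 hA hf hx
      have h3 : 1 ≤ R⁻¹ * x.2 := by
        rw [← div_eq_inv_mul, one_le_div hR]; linarith
      have h4 : f x * Gop f x ≤ f x * Cb q A := by gcongr
      have h5 : f x * Cb q A ≤ f x * Cb q A * (R⁻¹ * x.2) :=
        le_mul_of_one_le_right (by positivity) h3
      have : 0 ≤ eb p q A ρ * f x := by positivity
      linarith
  have hm := hf.meas
  refine (lintegral_mono_ae key).trans ?_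
  refine (lintegral_mono' Measure.restrict_le_self le_rfl).trans ?_
  rw [lintegral_add_left' (by fun_prop), lintegral_const_mul' _ _ ENNReal.ofReal_ne_top,
    lintegral_const_mul' _ _ ENNReal.ofReal_ne_top, ENNReal.ofReal_add (by positivity)
    (by positivity), ENNReal.ofReal_mul (q := A) (by positivity),
    ENNReal.ofReal_mul (q := A) (by positivity)]
  gcongr
  · exact hf.imp
  · exact hf.mass

lemma Good.memLp (hpq : p.HolderConjugate q) (hf : Good p A f) :
    MemLp f (ENNReal.ofReal p) μUH := by
  have hp := hpq.pos
  refine ⟨hf.meas.aestronglyMeasurable, ?_⟩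
  rw [eLpNorm_eq_lintegral_rpow_enorm_toReal (by simpa using hp) ENNReal.ofReal_ne_top,
        ENNReal.toReal_ofReal hp.le]
  refine lt_of_le_of_lt ?_ (ENNReal.ofReal_lt_top (r := A))
  refine le_trans (le_of_eq ?_) hf.lp
  congr 1
  apply lintegral_congr
  intro y
  rw [Real.enorm_eq_ofReal (hf.nonneg y)]

lemma Good.lp_real (hpq : p.HolderConjugate q) (hA : 0 ≤ A) (hf : Good p A f) :
    (∫ x, f x ^ p ∂μUH) ^ (1 / p) ≤ A := by
  have hp := hpq.pos
  have hm := hf.meas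
  rw [integral_eq_lintegral_of_nonneg_ae
    (ae_of_all _ fun x => Real.rpow_nonneg (hf.nonneg x) p)
    (by apply AEMeasurable.aestronglyMeasurable; fun_prop), ENNReal.toReal_rpow]
  apply ENNReal.toReal_le_of_le_ofReal hA
  refine le_trans (le_of_eq ?_) hf.lp
  congr 1
  apply lintegral_congr
  intro y
  rw [ENNReal.ofReal_rpow_of_nonneg (hf.nonneg y) hp.le]

lemma box_tendsto (hpq : p.HolderConjugate q) (hq2 : q < 2) (hA : 0 ≤ A)
    {ζn : ℕ → ℝ × ℝ → ℝ} {ζ : ℝ × ℝ → ℝ} (hn : ∀ n, Good p A (ζn n)) (hζ : Good p A ζ)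
    (hweak : ∀ g : ℝ × ℝ → ℝ, MemLp g (ENNReal.ofReal q) μUH →
      Tendsto (fun n => ∫ x, ζn n x * g x ∂μUH) atTop (nhds (∫ x, ζ x * g x ∂μUH))) (R : ℝ) :
    Tendsto (fun n => ∫ x in bx R, ζn n x * Gop (ζn n) x ∂μUH) atTop
      (𝓝 (∫ x in bx R, ζ x * Gop ζ x ∂μUH)) := by
  have hq := hpq.symm.pos
  have hC := Cb_nonneg (q := q) hA
  have hB := bx_meas R
  set u : (ℝ × ℝ → ℝ) → ℝ × ℝ → ℝ := fun f => (bx R).indicator (Gop f) with hu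
  have eq1 : ∀ f g : ℝ × ℝ → ℝ, ∫ x in bx R, f x * Gop g x ∂μUH = ∫ x, f x * u g x ∂μUH := by
    intro f g
    rw [← integral_indicator hB]
    congr 1; ext y
    by_cases hy : y ∈ bx R
    · simp only [hu, Set.indicator_of_mem hy]
    · simp only [hu, Set.indicator_of_notMem hy, mul_zero]
  have ubd : ∀ f, Good p A f → ∀ᵐ x ∂μUH, 0 ≤ u f x ∧
      u f x ≤ (bx R).indicator (fun _ => Cb q A) x := by
    intro f hf
    filter_upwards [ae_uhp] with x hx
    by_cases hy : x ∈ bx R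
    · simp only [hu, Set.indicator_of_mem hy]
      exact ⟨Gop_nonneg hf hx, Gop_le hpq hq2 hA hf hx⟩
    · simp only [hu, Set.indicator_of_notMem hy, le_refl, and_self]
  have umeas : ∀ f, Good p A f → AEStronglyMeasurable (u f) μUH := fun f hf =>
    (Gop_meas hf).indicator hB
  have cmem : ∀ r : ENNReal, MemLp ((bx R).indicator (fun _ => Cb q A)) r μUH := fun r =>
    memLp_indicator_const _ hB _ (Or.inr (bx_finite R).ne)
  have umem : ∀ f, Good p A f → MemLp (u f) (ENNReal.ofReal q) μUH := by
    intro f hf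
    refine (cmem _).of_le (umeas f hf) ?_
    filter_upwards [ubd f hf] with x hx
    rw [Real.norm_of_nonneg hx.1]
    exact hx.2.trans (le_abs_self _)
  -- the `L^q` norm of the difference tends to zero
  have hdom : Tendsto (fun n => ∫ x, |u (ζn n) x - u ζ x| ^ q ∂μUH) atTop (𝓝 0) := by
    have h0 : (0 : ℝ) = ∫ x, (0 : ℝ) ∂μUH := by simp
    rw [h0]
    apply tendsto_integral_of_dominated_convergence
      (fun x => (bx R).indicator (fun _ => Cb q A ^ q) x)
    · intro n
      have := ((umeas _ (hn n)).sub (umeas _ hζ)).aemeasurable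
      apply AEMeasurable.aestronglyMeasurable
      simp only [← Real.norm_eq_abs]
      exact this.norm.pow_const q
    · rw [integrable_indicator_iff hB]
      exact integrableOn_const (bx_finite R).ne
    · intro n
      filter_upwards [ubd _ (hn n), ubd _ hζ] with x h1 h2
      by_cases hy : x ∈ bx R
      · rw [Set.indicator_of_mem hy] at *
        rw [Real.norm_of_nonneg (by positivity)]
        apply Real.rpow_le_rpow (by positivity) _ hq.le
        rw [abs_le]; constructor <;> linarith
      · simp [hu, Set.indicator_of_notMem hy, hq.ne']
    · filter_upwards [ae_uhp] with x hx
      have h1 : Tendsto (fun n => u (ζn n) x) atTop (𝓝 (u ζ x)) := by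
        by_cases hy : x ∈ bx R
        · simp only [hu, Set.indicator_of_mem hy]
          exact Gop_tendsto hpq hq2 hA hn hζ hweak hx
        · simp only [hu, Set.indicator_of_notMem hy]; exact tendsto_const_nhds
      have h2 : Tendsto (fun n => |u (ζn n) x - u ζ x|) atTop (𝓝 0) := by
        have := (h1.sub_const (u ζ x)).abs
        simpa using this
      have h3 := h2.rpow_const (p := q) (Or.inr hq.le)
      rwa [Real.zero_rpow hq.ne'] at h3
  have hd2 : Tendsto (fun n => A * (∫ x, |u (ζn n) x - u ζ x| ^ q ∂μUH) ^ (1 / q)) atTop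
      (𝓝 0) := by
    have h3 := (hdom.rpow_const (p := 1 / q) (Or.inr (by positivity))).const_mul A
    rwa [Real.zero_rpow (by positivity), mul_zero] at h3
  have : ENNReal.HolderConjugate (ENNReal.ofReal p) (ENNReal.ofReal q) :=
    hpq.ennrealOfReal
  have hint : ∀ f g, Good p A f → Good p A g → Integrable (fun x => f x * u g x) μUH :=
    fun f g hf hg => (hf.memLp hpq).integrable_mul (umem g hg)
  have hdiff : Tendsto (fun n => ∫ x, ζn n x * (u (ζn n) x - u ζ x) ∂μUH) atTop (𝓝 0) := by
    apply squeeze_zero_norm _ hd2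
    intro n
    refine (norm_integral_le_integral_norm _).trans ?_
    have hol := integral_mul_le_Lp_mul_Lq_of_nonneg hpq (f := ζn n)
      (g := fun x => |u (ζn n) x - u ζ x|) (ae_of_all _ (hn n).nonneg)
      (ae_of_all _ fun x => abs_nonneg _) ((hn n).memLp hpq)
      (((umem _ (hn n)).sub (umem _ hζ)).norm)
    have e : ∀ x, ‖ζn n x * (u (ζn n) x - u ζ x)‖ = ζn n x * |u (ζn n) x - u ζ x| := fun x => by
      rw [norm_mul, Real.norm_of_nonneg ((hn n).nonneg x), Real.norm_eq_abs]
    simp only [e]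
    refine hol.trans ?_
    gcongr
    exact (hn n).lp_real hpq hA
  have hlast := hdiff.add (hweak _ (umem ζ hζ))
  rw [zero_add] at hlast
  rw [eq1]
  refine hlast.congr fun n => ?_
  rw [eq1, ← integral_add]
  · congr 1; ext x; ring
  · have := (hint _ _ (hn n) (hn n)).sub (hint _ _ (hn n) hζ)
    refine this.congr (ae_of_all _ fun x => ?_)
    simp only [Pi.sub_apply]; ring
  · exact hint _ _ (hn n) hζ

lemma energy_tendsto (hpq : p.HolderConjugate q) (hq2 : q < 2) (hA : 0 ≤ A)
    {ζn : ℕ → ℝ × ℝ → ℝ} {ζ : ℝ × ℝ → ℝ} (hn : ∀ n, Good p A (ζn n)) (hζ : Good p A ζ)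
    (hsym : ∀ n, SteinerSym (ζn n))
    (hweak : ∀ g : ℝ × ℝ → ℝ, MemLp g (ENNReal.ofReal q) μUH →
      Tendsto (fun n => ∫ x, ζn n x * g x ∂μUH) atTop (nhds (∫ x, ζ x * g x ∂μUH))) :
    Tendsto (fun n => energy (ζn n)) atTop (nhds (energy ζ)) := by
  unfold energy
  apply Tendsto.const_mul
  set ρ : ℕ → ℝ := fun k => (k : ℝ) + 1 with hρ
  have hρ0 : ∀ k, 0 < ρ k := fun k => by simp only [hρ]; positivity
  have hinv : Tendsto (fun k => (ρ k)⁻¹) atTop (𝓝 0) := tendsto_inv_succ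
  have hp := hpq.pos
  have he : Tendsto (fun k => Cb q A * (ρ k ^ 2 + ρ k)⁻¹ * A + eb p q A (ρ k) * A) atTop
      (𝓝 0) := by
    have h1 : Tendsto (fun k => (ρ k ^ 2 + ρ k)⁻¹) atTop (𝓝 0) := by
      refine squeeze_zero (fun k => by have := hρ0 k; positivity) (fun k => ?_) hinv
      apply inv_anti₀ (hρ0 k)
      nlinarith [sq_nonneg (ρ k)]
    have h2 : Tendsto (fun k => eb p q A (ρ k)) atTop (𝓝 0) := by
      unfold eb
      have h3 := hinv.rpow_const (p := 1 / p) (Or.inr (by positivity))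
      rw [Real.zero_rpow (by positivity)] at h3
      simpa using (hinv.const_mul (2 * A)).add ((h3.mul_const A).mul_const (kap q).toReal)
    simpa using ((h1.const_mul (Cb q A)).mul_const A).add (h2.mul_const A)
  have hmono : Monotone fun k => bx (ρ k ^ 2 + ρ k) := by
    intro i j hij x hx
    have h1 : ρ i ≤ ρ j := by simp only [hρ]; gcongr
    have h2 : ρ i ^ 2 + ρ i ≤ ρ j ^ 2 + ρ j := by
      have := (hρ0 i).le
      gcongr
    exact ⟨hx.1.trans h2, hx.2.trans h2⟩
  have hU : ⋃ k, bx (ρ k ^ 2 + ρ k) = Set.univ := by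
    rw [Set.eq_univ_iff_forall]
    intro x
    obtain ⟨k, hk⟩ := exists_nat_ge (|x.1| + |x.2|)
    rw [Set.mem_iUnion]
    refine ⟨k, ?_, ?_⟩ <;> simp only [hρ] <;>
      nlinarith [abs_nonneg x.1, abs_nonneg x.2, le_abs_self x.2, sq_nonneg ((k:ℝ) + 1)]
  have hlim := tendsto_setIntegral_of_monotone (fun k => bx_meas (ρ k ^ 2 + ρ k)) hmono
    (energy_integrable hpq hq2 hA hζ).integrableOn
  rw [hU, Measure.restrict_univ] at hlim
  refine interchange (e' := fun k => |∫ x, ζ x * Gop ζ x ∂μUH -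
    ∫ x in bx (ρ k ^ 2 + ρ k), ζ x * Gop ζ x ∂μUH|)
    (fun k => box_tendsto hpq hq2 hA hn hζ hweak (ρ k ^ 2 + ρ k)) he ?_
    (fun k n => tail_bound hpq hq2 hA (hn n) (hsym n) (hρ0 k)) (fun k => le_rfl)
  have := (hlim.const_sub (∫ x, ζ x * Gop ζ x ∂μUH)).abs
  simpa using this

end

/-! ### Uniform bounds from weak convergence -/

lemma weight_bound {q A : ℝ} (hA : 0 ≤ A)
    {ζn : ℕ → ℝ × ℝ → ℝ} {ζ : ℝ × ℝ → ℝ} (hn : ∀ n x, 0 ≤ ζn n x)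
    (hnm : ∀ n, AEMeasurable (ζn n) μUH) (hζ : ∀ x, 0 ≤ ζ x) (hζm : AEMeasurable ζ μUH)
    (hweak : ∀ g : ℝ × ℝ → ℝ, MemLp g (ENNReal.ofReal q) μUH →
      Tendsto (fun n => ∫ x, ζn n x * g x ∂μUH) atTop (nhds (∫ x, ζ x * g x ∂μUH)))
    (hζint : ∀ g : ℝ × ℝ → ℝ, MemLp g (ENNReal.ofReal q) μUH →
      Integrable (fun x => ζ x * g x) μUH)
    {w : ℝ × ℝ → ℝ} (hw : Measurable w) (hw0 : ∀ y : ℝ × ℝ, 0 < y.2 → 0 ≤ w y)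
    (hwb : ∀ R, ∃ c, ∀ y ∈ bx R, 0 < y.2 → w y ≤ c)
    (h : ∀ n, ∫⁻ y, ENNReal.ofReal (ζn n y * w y) ∂μUH ≤ ENNReal.ofReal A) :
    ∫⁻ y, ENNReal.ofReal (ζ y * w y) ∂μUH ≤ ENNReal.ofReal A := by
  have hU : ⋃ k : ℕ, bx k = Set.univ := by
    rw [Set.eq_univ_iff_forall]
    intro x
    obtain ⟨k, hk⟩ := exists_nat_ge (|x.1| + |x.2|)
    rw [Set.mem_iUnion]
    refine ⟨k, ?_, ?_⟩ <;>
      linarith [abs_nonneg x.1, abs_nonneg x.2, le_abs_self x.2]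
  have hmono : Monotone fun k : ℕ => bx (k : ℝ) := by
    intro i j hij x hx
    have : (i : ℝ) ≤ j := by exact_mod_cast hij
    exact ⟨hx.1.trans this, hx.2.trans this⟩
  rw [← setLIntegral_univ, ← hU, setLIntegral_iUnion_of_directed _ hmono.directed_le]
  apply iSup_le
  intro k
  have hB := bx_meas (k : ℝ)
  set g : ℝ × ℝ → ℝ := (bx (k : ℝ)).indicator w with hg
  have hgm : Measurable g := hw.indicator hB
  have hg0 : ∀ᵐ y ∂μUH, 0 ≤ g y := by
    filter_upwards [ae_uhp] with y hy
    by_cases hyB : y ∈ bx (k : ℝ)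
    · rw [hg, Set.indicator_of_mem hyB]; exact hw0 y hy
    · rw [hg, Set.indicator_of_notMem hyB]
  have hgw : ∀ᵐ y ∂μUH, g y ≤ w y := by
    filter_upwards [ae_uhp] with y hy
    by_cases hyB : y ∈ bx (k : ℝ)
    · rw [hg, Set.indicator_of_mem hyB]
    · rw [hg, Set.indicator_of_notMem hyB]; exact hw0 y hy
  obtain ⟨c, hc⟩ := hwb k
  have hgmem : MemLp g (ENNReal.ofReal q) μUH := by
    have m1 : MemLp ((bx (k : ℝ)).indicator (fun _ => c)) (ENNReal.ofReal q) μUH :=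
      memLp_indicator_const _ hB _ (Or.inr (bx_finite k).ne)
    refine m1.of_le hgm.aestronglyMeasurable ?_
    filter_upwards [ae_uhp, hg0] with y hy hy0
    rw [Real.norm_of_nonneg hy0]
    refine le_trans ?_ (le_abs_self _)
    by_cases hyB : y ∈ bx (k : ℝ)
    · rw [hg, Set.indicator_of_mem hyB, Set.indicator_of_mem hyB]; exact hc y hyB hy
    · rw [hg, Set.indicator_of_notMem hyB, Set.indicator_of_notMem hyB]
  have hle : ∫ x, ζ x * g x ∂μUH ≤ A := by
    refine le_of_tendsto' (hweak g hgmem) fun n => ?_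
    have hmn := hnm n
    rw [integral_eq_lintegral_of_nonneg_ae]
    · apply ENNReal.toReal_le_of_le_ofReal hA
      refine (lintegral_mono_ae ?_).trans (h n)
      filter_upwards [hgw] with y hy
      exact ENNReal.ofReal_le_ofReal (mul_le_mul_of_nonneg_left hy (hn n y))
    · filter_upwards [hg0] with y hy
      exact mul_nonneg (hn n y) hy
    · exact (hmn.mul hgm.aemeasurable).aestronglyMeasurable
  have e : ∫⁻ y in bx (k : ℝ), ENNReal.ofReal (ζ y * w y) ∂μUH =
      ENNReal.ofReal (∫ x, ζ x * g x ∂μUH) := by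
    rw [ofReal_integral_eq_lintegral_ofReal (hζint g hgmem), ← lintegral_indicator hB]
    · apply lintegral_congr
      intro y
      by_cases hyB : y ∈ bx (k : ℝ)
      · simp only [hg, Set.indicator_of_mem hyB]
      · simp only [hg, Set.indicator_of_notMem hyB, mul_zero, ENNReal.ofReal_zero]
    · filter_upwards [hg0] with y hy
      exact mul_nonneg (hζ y) hy
  rw [e]
  exact ENNReal.ofReal_le_ofReal hle

lemma lp_bound {p q : ℝ} (hpq : p.HolderConjugate q)
    {ζn : ℕ → ℝ × ℝ → ℝ} {ζ : ℝ × ℝ → ℝ} (hn : ∀ n x, 0 ≤ ζn n x)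
    (hmem : ∀ n, MemLp (ζn n) (ENNReal.ofReal p) μUH)
    (hweak : ∀ g : ℝ × ℝ → ℝ, MemLp g (ENNReal.ofReal q) μUH →
      Tendsto (fun n => ∫ x, ζn n x * g x ∂μUH) atTop (nhds (∫ x, ζ x * g x ∂μUH))) :
    ∃ C : ℝ, ∀ n, eLpNorm (ζn n) (ENNReal.ofReal p) μUH ≤ ENNReal.ofReal C := by
  have hp := hpq.pos
  have hq := hpq.symm.pos
  have i1 : ENNReal.HolderConjugate (ENNReal.ofReal p) (ENNReal.ofReal q) :=
    hpq.ennrealOfReal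
  have i2 : Fact (1 ≤ ENNReal.ofReal p) := ⟨by simpa using hpq.lt.le⟩
  have i3 : Fact (1 ≤ ENNReal.ofReal q) := ⟨by simpa using hpq.symm.lt.le⟩
  set T : ℕ → Lp ℝ (ENNReal.ofReal q) μUH →L[ℝ] ℝ := fun n =>
    (ContinuousLinearMap.mul ℝ ℝ).lpPairing μUH (ENNReal.ofReal p) (ENNReal.ofReal q)
      ((hmem n).toLp (ζn n)) with hT
  have hTeq : ∀ n g, T n g = ∫ x, ζn n x * g x ∂μUH := by
    intro n g
    simp only [hT, ContinuousLinearMap.lpPairing_eq_integral, ContinuousLinearMap.mul_apply']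
    apply integral_congr_ae
    filter_upwards [(hmem n).coeFn_toLp] with x hx
    rw [hx]
  obtain ⟨C, hC⟩ := banach_steinhaus (g := T) (by
    intro g
    have := (hweak g (Lp.memLp g)).norm.bddAbove_range
    obtain ⟨c, hc⟩ := this
    refine ⟨c, fun n => ?_⟩
    rw [hTeq]
    exact hc ⟨n, rfl⟩)
  refine ⟨C, fun n => ?_⟩
  have hC0 : 0 ≤ C := (norm_nonneg _).trans (hC 0)
  have hpp : (p - 1) * q = p := hpq.sub_one_mul_conj
  have hp0 : ENNReal.ofReal p ≠ 0 := by simpa using hp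
  have hq0 : ENNReal.ofReal q ≠ 0 := by simpa using hq
  set g : ℝ × ℝ → ℝ := fun x => ζn n x ^ (p - 1) with hg
  have hgn : ∀ x, ‖g x‖ ^ q = ζn n x ^ p := fun x => by
    rw [Real.norm_of_nonneg (Real.rpow_nonneg (hn n x) _), ← Real.rpow_mul (hn n x), hpp]
  have hgm : AEStronglyMeasurable g μUH := (((hmem n).1.aemeasurable).pow_const _).aestronglyMeasurable
  have hgmem : MemLp g (ENNReal.ofReal q) μUH := by
    rw [← integrable_norm_rpow_iff hgm hq0 ENNReal.ofReal_ne_top, ENNReal.toReal_ofReal hq.le]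
    have := (hmem n).integrable_norm_rpow hp0 ENNReal.ofReal_ne_top
    rw [ENNReal.toReal_ofReal hp.le] at this
    refine this.congr (ae_of_all _ fun x => ?_)
    simp only [hgn, Real.norm_of_nonneg (hn n x)]
  set M : ℝ := ∫ x, ζn n x ^ p ∂μUH with hM
  have hM0 : 0 ≤ M := integral_nonneg fun x => Real.rpow_nonneg (hn n x) _
  have hbound : M ≤ C * M ^ (1 / q) := by
    have h1 : T n (hgmem.toLp g) = M := by
      rw [hTeq, hM]
      apply integral_congr_ae
      filter_upwards [hgmem.coeFn_toLp] with x hx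
      rw [hx, hg]
      have := hpq.sub_one_pos
      rw [← Real.rpow_one_add' (hn n x) (by linarith)]
      congr 1; ring
    have h2 : ‖hgmem.toLp g‖ = M ^ (1 / q) := by
      rw [Lp.norm_toLp, hgmem.eLpNorm_eq_integral_rpow_norm hq0 ENNReal.ofReal_ne_top,
        ENNReal.toReal_ofReal hq.le, ENNReal.toReal_ofReal]
      · simp only [hgn, one_div, hM]
      · simp only [hgn]; exact Real.rpow_nonneg hM0 _
    have h3 := (T n).le_of_opNorm_le (hC n) (hgmem.toLp g)
    rw [h1, h2] at h3
    exact (le_abs_self M).trans h3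
  rw [(hmem n).eLpNorm_eq_integral_rpow_norm hp0 ENNReal.ofReal_ne_top, ENNReal.toReal_ofReal hp.le]
  apply ENNReal.ofReal_le_ofReal
  simp only [Real.norm_of_nonneg (hn n _), ← hM]
  rcases hM0.eq_or_lt with h | h
  · rw [← h, Real.zero_rpow (by positivity)]; exact hC0
  · have e : p⁻¹ = 1 - 1 / q := by have := hpq.inv_add_inv_eq_one; rw [one_div]; linarith
    rw [e, Real.rpow_sub h, Real.rpow_one, div_le_iff₀ (by positivity)]
    exact hbound

lemma lp_conv {p : ℝ} (hp : 0 < p) {f : ℝ × ℝ → ℝ} (hf : ∀ x, 0 ≤ f x) :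
    (∫⁻ y, ENNReal.ofReal (f y) ^ p ∂μUH) ^ (1 / p) = eLpNorm f (ENNReal.ofReal p) μUH := by
  rw [eLpNorm_eq_lintegral_rpow_enorm_toReal (by simpa using hp) ENNReal.ofReal_ne_top,
        ENNReal.toReal_ofReal hp.le]
  congr 1
  apply lintegral_congr
  intro y
  rw [Real.enorm_eq_ofReal (hf y)]

lemma energy_congr {f g : ℝ × ℝ → ℝ} (h : f =ᵐ[μUH] g) : energy f = energy g := by
  have hG : Gop f = Gop g := by
    ext x
    unfold Gop
    apply integral_congr_ae
    filter_upwards [h] with y hy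
    rw [hy]
  unfold energy
  rw [hG]
  congr 1
  apply integral_congr_ae
  filter_upwards [h] with y hy
  rw [hy]

/-- Lemma 6: continuity of the energy along weakly convergent Steiner-symmetric
sequences with bounded `L¹` norms and impulses. -/
theorem stmt_5 (p q : ℝ) (hp : 2 < p) (hpq : 1 / p + 1 / q = 1)
    (ζn : ℕ → ℝ × ℝ → ℝ) (ζ : ℝ × ℝ → ℝ)
    (hnn : ∀ n x, 0 ≤ ζn n x)
    (hsym : ∀ n, SteinerSym (ζn n))
    (hmem : ∀ n, MemLp (ζn n) (ENNReal.ofReal p) μUH)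
    (hint : ∀ n, Integrable (ζn n) μUH)
    (himpint : ∀ n, Integrable (fun y => ζn n y * y.2) μUH)
    (hbdd : ∃ C : ℝ, ∀ n, lpN 1 (ζn n) ≤ C ∧ impulse (ζn n) ≤ C)
    (hζmem : MemLp ζ (ENNReal.ofReal p) μUH)
    (hweak : ∀ g : ℝ × ℝ → ℝ, MemLp g (ENNReal.ofReal q) μUH →
      Tendsto (fun n => ∫ x, ζn n x * g x ∂μUH) atTop (nhds (∫ x, ζ x * g x ∂μUH))) :
    Tendsto (fun n => energy (ζn n)) atTop (nhds (energy ζ)) := by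
  obtain ⟨C, hC⟩ := hbdd
  have hp0 : 0 < p := by linarith
  have hqinv : 1 / q = 1 - 1 / p := by linarith
  have hpinv : 1 / p < 1 / 2 := one_div_lt_one_div_of_lt (by norm_num) hp
  have hq0 : 0 < q := by
    have : 0 < 1 / q := by linarith
    exact one_div_pos.1 this
  have hq2 : q < 2 := by
    have : 1 / 2 < 1 / q := by linarith
    exact lt_of_one_div_lt_one_div (by norm_num) this
  have hH : p.HolderConjugate q := Real.holderConjugate_iff.2 ⟨by linarith, by simpa using hpq⟩
  have i1 : ENNReal.HolderConjugate (ENNReal.ofReal p) (ENNReal.ofReal q) := hH.ennrealOfReal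
  -- nonnegativity of the limit
  have hsig : SigmaFinite μUH := by unfold μUH; infer_instance
  have hζint0 : ∀ g : ℝ × ℝ → ℝ, MemLp g (ENNReal.ofReal q) μUH →
      Integrable (fun x => ζ x * g x) μUH := fun g hg => hζmem.integrable_mul hg
  have hind : ∀ s : Set (ℝ × ℝ), MeasurableSet s → μUH s < ⊤ →
      MemLp (s.indicator (fun _ => (1 : ℝ))) (ENNReal.ofReal q) μUH := fun s hs hfin =>
    memLp_indicator_const _ hs _ (Or.inr hfin.ne)
  have hmulind : ∀ (f : ℝ × ℝ → ℝ) (s : Set (ℝ × ℝ)),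
      (fun x => f x * s.indicator (fun _ => (1 : ℝ)) x) = s.indicator f := by
    intro f s
    ext x
    by_cases hx : x ∈ s
    · simp [Set.indicator_of_mem hx]
    · simp [Set.indicator_of_notMem hx]
  have hζae : 0 ≤ᵐ[μUH] ζ := by
    apply ae_nonneg_of_forall_setIntegral_nonneg_of_sigmaFinite
    · intro s hs hfin
      have := hζint0 _ (hind s hs hfin)
      rw [hmulind, integrable_indicator_iff hs] at this
      exact this
    · intro s hs hfin
      have h1 := hweak _ (hind s hs hfin)
      simp only [hmulind] at h1
      rw [integral_indicator hs] at h1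
      refine ge_of_tendsto' h1 fun n => ?_
      exact integral_nonneg fun x => Set.indicator_nonneg (fun y _ => hnn n y) x
  -- replace the limit by a nonnegative representative
  set η : ℝ × ℝ → ℝ := fun x => max (ζ x) 0 with hη
  have hηζ : ζ =ᵐ[μUH] η := by
    filter_upwards [hζae] with x hx
    exact (max_eq_left hx).symm
  have hη0 : ∀ x, 0 ≤ η x := fun x => le_max_right _ _
  have hηmem : MemLp η (ENNReal.ofReal p) μUH := hζmem.ae_eq hηζ
  have hηm : AEMeasurable η μUH := hηmem.1.aemeasurable
  have hweak' : ∀ g : ℝ × ℝ → ℝ, MemLp g (ENNReal.ofReal q) μUH →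
      Tendsto (fun n => ∫ x, ζn n x * g x ∂μUH) atTop (nhds (∫ x, η x * g x ∂μUH)) := by
    intro g hg
    have : ∫ x, η x * g x ∂μUH = ∫ x, ζ x * g x ∂μUH := by
      apply integral_congr_ae
      filter_upwards [hηζ] with x hx
      rw [hx]
    rw [this]
    exact hweak g hg
  have hηint : ∀ g : ℝ × ℝ → ℝ, MemLp g (ENNReal.ofReal q) μUH →
      Integrable (fun x => η x * g x) μUH := fun g hg => hηmem.integrable_mul hg
  obtain ⟨D, hD⟩ := lp_bound hH hnn hmem hweak
  set A : ℝ := max (max C D) (max 0 (eLpNorm η (ENNReal.ofReal p) μUH).toReal) with hAdef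
  have hCA : C ≤ A := (le_max_left _ _).trans (le_max_left _ _)
  have hDA : D ≤ A := (le_max_right _ _).trans (le_max_left _ _)
  have hA : 0 ≤ A := (le_max_left _ _).trans (le_max_right _ _)
  have hηA : (eLpNorm η (ENNReal.ofReal p) μUH).toReal ≤ A :=
    (le_max_right _ _).trans (le_max_right _ _)
  have hgood : ∀ n, Good p A (ζn n) := by
    intro n
    refine ⟨hnn n, (hmem n).1.aemeasurable, ?_, ?_, ?_⟩
    · have h1 := (hC n).1.trans hCA
      unfold lpN at h1
      rw [ENNReal.ofReal_one, eLpNorm_one_eq_lintegral_enorm] at h1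
      have h2 := (ENNReal.le_ofReal_iff_toReal_le (hint n).2.ne hA).2 h1
      refine le_trans (le_of_eq (lintegral_congr fun y => ?_)) h2
      rw [Real.enorm_eq_ofReal (hnn n y)]
    · have h1 := (hC n).2.trans hCA
      unfold impulse at h1
      rw [← ofReal_integral_eq_lintegral_ofReal (himpint n)]
      · exact ENNReal.ofReal_le_ofReal h1
      · filter_upwards [ae_uhp] with y hy
        exact mul_nonneg (hnn n y) hy.le
    · rw [lp_conv hp0 (hnn n)]
      exact (hD n).trans (ENNReal.ofReal_le_ofReal hDA)
  have hgη : Good p A η := by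
    refine ⟨hη0, hηm, ?_, ?_, ?_⟩
    · have := weight_bound (w := fun _ => 1) hA hnn (fun n => (hgood n).meas) hη0 hηm hweak' hηint
        measurable_const (fun _ _ => zero_le_one) (fun R => ⟨1, fun _ _ _ => le_rfl⟩)
        (fun n => by simpa using (hgood n).mass)
      simpa using this
    · exact weight_bound (w := fun y => y.2) hA hnn (fun n => (hgood n).meas) hη0 hηm hweak' hηint
        measurable_snd (fun _ h => h.le) (fun R => ⟨R, fun _ h _ => h.2⟩)
        (fun n => (hgood n).imp)
    · rw [lp_conv hp0 hη0]
      exact (ENNReal.le_ofReal_iff_toReal_le hηmem.2.ne hA).2 hηA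
  rw [energy_congr hηζ]
  exact energy_tendsto hH hq2 hA hgood hgη hsym hweak'
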